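/- arXiv:2307.08212 — 2 statements merged into one kernel-verified Lean document; each statement's English description precedes it below -/
import Mathlib

section
/- Suppose there exist reals ε_X, ε_Y ∈ [0,1] with ε_X · ε_Y > 0 such that d_TV(π_X^y, π_X^{y'}) ≤ 1 − ε_X for all y, y' ∈ 𝒴, and d_TV(π_Y^x, π_Y^{x'}) ≤ 1 − ε_Y for all x, x' ∈ 𝒳. Let π_min = min{π(x,y) : (x,y) ∈ 𝒳 × 𝒴, π(x,y) > 0}. Then for every function f : 𝒳 × 𝒴 → ℝ≥0, Ent f ≤ ((4 + 2 log(1/π_min))/(ε_X + ε_Y)) · (E[Ent_X f] + E[Ent_Y f]). -/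
open scoped BigOperators Classical

noncomputable section

/-- Expectation of `f` under the (finitely supported) density `p`. -/
def pmean {α : Type*} [Fintype α] (p f : α → ℝ) : ℝ := ∑ a, p a * f a

/-- Variance of `f` under the density `p`. -/
def pvar {α : Type*} [Fintype α] (p f : α → ℝ) : ℝ :=
  pmean p (fun a => (f a - pmean p f) ^ 2)

/-- Entropy of `f` under the density `p` (with the convention `0 log 0 = 0`,
which is automatic since `Real.log 0 = 0`). -/
def pent {α : Type*} [Fintype α] (p f : α → ℝ) : ℝ :=
  pmean p (fun a => f a * Real.log (f a)) - pmean p f * Real.log (pmean p f)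

/-- Total variation distance between two densities. -/
def ptv {α : Type*} [Fintype α] (p q : α → ℝ) : ℝ := (1 / 2) * ∑ a, |p a - q a|

/-- Marginal on the first coordinate. -/
def margX {X Y : Type*} [Fintype X] [Fintype Y] (π : X × Y → ℝ) : X → ℝ :=
  fun x => ∑ y, π (x, y)

/-- Marginal on the second coordinate. -/
def margY {X Y : Type*} [Fintype X] [Fintype Y] (π : X × Y → ℝ) : Y → ℝ :=
  fun y => ∑ x, π (x, y)

/-- Conditional distribution of the first coordinate given the second equals `y`. -/
def condX {X Y : Type*} [Fintype X] [Fintype Y] (π : X × Y → ℝ) (y : Y) : X → ℝ :=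
  fun x => π (x, y) / margY π y

/-- Conditional distribution of the second coordinate given the first equals `x`. -/
def condY {X Y : Type*} [Fintype X] [Fintype Y] (π : X × Y → ℝ) (x : X) : Y → ℝ :=
  fun y => π (x, y) / margX π x

section Weighted

variable {α : Type*} [Fintype α]

lemma pmean_const {p : α → ℝ} (hp1 : ∑ a, p a = 1) (c : ℝ) : pmean p (fun _ => c) = c := by
  simp [pmean, ← Finset.sum_mul, hp1]

lemma pmean_mono {p f g : α → ℝ} (hp : ∀ a, 0 ≤ p a) (h : ∀ a, f a ≤ g a) :
    pmean p f ≤ pmean p g :=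
  Finset.sum_le_sum fun a _ => mul_le_mul_of_nonneg_left (h a) (hp a)

lemma pmean_sub (p f g : α → ℝ) : pmean p (fun a => f a - g a) = pmean p f - pmean p g := by
  simp [pmean, mul_sub, Finset.sum_sub_distrib]

lemma pmean_const_mul (p f : α → ℝ) (c : ℝ) : pmean p (fun a => c * f a) = c * pmean p f := by
  simp only [pmean, Finset.mul_sum]
  exact Finset.sum_congr rfl fun a _ => by ring

lemma pmean_sq_nonneg {p : α → ℝ} (hp : ∀ a, 0 ≤ p a) (f : α → ℝ) :
    0 ≤ pmean p (fun a => f a ^ 2) :=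
  Finset.sum_nonneg fun a _ => mul_nonneg (hp a) (sq_nonneg _)

lemma sq_pmean_mul_le {p : α → ℝ} (hp : ∀ a, 0 ≤ p a) (f g : α → ℝ) :
    pmean p (fun a => f a * g a) ^ 2 ≤
      pmean p (fun a => f a ^ 2) * pmean p (fun a => g a ^ 2) :=
  Finset.sum_sq_le_sum_mul_sum_of_sq_le_mul _
    (fun a _ => mul_nonneg (hp a) (sq_nonneg _)) (fun a _ => mul_nonneg (hp a) (sq_nonneg _))
    fun a _ => le_of_eq (by ring)

lemma pvar_eq {p : α → ℝ} (hp1 : ∑ a, p a = 1) (f : α → ℝ) :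
    pvar p f = pmean p (fun a => f a ^ 2) - pmean p f ^ 2 := by
  have h : ∀ m : ℝ, pmean p (fun a => (f a - m) ^ 2) =
      pmean p (fun a => f a ^ 2) - 2 * m * pmean p f + m ^ 2 := by
    intro m
    have h1 : ∀ a, p a * (f a - m) ^ 2 =
        p a * f a ^ 2 - 2 * m * (p a * f a) + p a * m ^ 2 := fun a => by ring
    simp only [pmean, h1, Finset.sum_add_distrib, Finset.sum_sub_distrib, ← Finset.mul_sum,
      ← Finset.sum_mul, hp1, one_mul]
  rw [pvar, h]
  ring

lemma pvar_sub_const {p : α → ℝ} (hp1 : ∑ a, p a = 1) (f : α → ℝ) (c : ℝ) :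
    pvar p (fun a => f a - c) = pvar p f := by
  simp only [pvar, pmean_sub, pmean_const hp1, sub_sub_sub_cancel_right]

lemma pent_const_mul (p : α → ℝ) {f : α → ℝ} {c : ℝ} (hc : 0 < c) (hm : pmean p f ≠ 0) :
    pent p (fun a => c * f a) = c * pent p f := by
  have h : ∀ a, c * f a * Real.log (c * f a) =
      c * (f a * Real.log (f a)) - (-(c * Real.log c)) * f a := by
    intro a
    rcases eq_or_ne (f a) 0 with h0 | h0
    · simp [h0]
    · rw [Real.log_mul hc.ne' h0]
      ring
  simp only [pent, h, pmean_sub, pmean_const_mul, Real.log_mul hc.ne' hm]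
  ring

/-- The variance of a nonnegative function is at most the entropy of its square. -/
lemma pvar_le_pent_sq {p : α → ℝ} (hp : ∀ a, 0 ≤ p a) (hp1 : ∑ a, p a = 1) {g : α → ℝ}
    (hg : ∀ a, 0 ≤ g a) : pvar p g ≤ pent p (fun a => g a ^ 2) := by
  rw [pvar_eq hp1, pent]
  set N := pmean p (fun a => g a ^ 2) with hN
  have hN0 : 0 ≤ N := pmean_sq_nonneg hp g
  rcases hN0.eq_or_lt with h0 | hNpos
  · have hz : ∀ a, p a * g a ^ 2 = 0 := fun a =>
      (Finset.sum_eq_zero_iff_of_nonneg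
        (fun a _ => mul_nonneg (hp a) (sq_nonneg (g a)))).1 h0.symm a (Finset.mem_univ a)
    have h2 : pmean p (fun a => g a ^ 2 * Real.log (g a ^ 2)) = 0 :=
      Finset.sum_eq_zero fun a _ => by rw [← mul_assoc, hz a, zero_mul]
    rw [h2, ← h0]
    nlinarith [sq_nonneg (pmean p g)]
  · have hr : 0 < √N := Real.sqrt_pos.2 hNpos
    have hrN : √N ^ 2 = N := Real.sq_sqrt hN0
    have key : ∀ a, 2 * g a ^ 2 - 2 * √N * g a ≤
        g a ^ 2 * Real.log (g a ^ 2) - Real.log N * g a ^ 2 := by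
      intro a
      rcases (hg a).eq_or_lt with h | h
      · simp [← h]
      · have h1 := Real.one_sub_inv_le_log_of_pos (div_pos h hr)
        rw [Real.log_div h.ne' hr.ne', Real.log_sqrt hN0, inv_div] at h1
        have h2 := mul_le_mul_of_nonneg_left h1 (sq_nonneg (g a))
        have h3 : g a ^ 2 * (1 - √N / g a) = g a ^ 2 - √N * g a := by field_simp
        rw [Real.log_pow]
        push_cast
        linarith
    have h := pmean_mono hp key
    simp only [pmean_sub, pmean_const_mul, ← hN] at h
    nlinarith [sq_nonneg (√N - pmean p g)]

/-- Total variation controls the difference of means by the oscillation of the function. -/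
lemma abs_pmean_sub_pmean_le {p q : α → ℝ} [Nonempty α] (hpq : ∑ a, p a = ∑ a, q a)
    {f : α → ℝ} {D : ℝ} (hf : ∀ a b, |f a - f b| ≤ D) :
    |pmean p f - pmean q f| ≤ ptv p q * D := by
  obtain ⟨u, hu⟩ := Finite.exists_max f
  obtain ⟨l, hl⟩ := Finite.exists_min f
  have h : pmean p f - pmean q f = ∑ a, (p a - q a) * (f a - (f u + f l) / 2) := by
    simp only [pmean, mul_sub, sub_mul, Finset.sum_sub_distrib, ← Finset.sum_mul, hpq]
    ring
  rw [h, ptv, mul_comm (1 / 2), mul_assoc, Finset.sum_mul]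
  refine (Finset.abs_sum_le_sum_abs _ _).trans (Finset.sum_le_sum fun a _ => ?_)
  rw [abs_mul]
  refine mul_le_mul_of_nonneg_left ?_ (abs_nonneg _)
  have := (abs_le.1 (hf u l)).2
  rw [abs_le]
  constructor <;> linarith [hu a, hl a]

end Weighted

section LogSobolev

variable {α : Type*} [Fintype α]

lemma log_sq_mul_le {s h B : ℝ} (hs : 0 ≤ s) (hy : 0 < 1 + s * h) (hB : 0 ≤ B)
    (hyB : Real.log ((1 + s * h) ^ 2) ≤ B) :
    Real.log ((1 + s * h) ^ 2) * (2 * (1 + s * h) * h) ≤ (4 + 2 * B) * s * h ^ 2 := by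
  have hlog : Real.log ((1 + s * h) ^ 2) = 2 * Real.log (1 + s * h) := by
    rw [Real.log_pow]
    norm_num
  have hsB : 0 ≤ s * h ^ 2 * B := by positivity
  rcases le_total 0 h with h0 | h0
  · have h1 : Real.log ((1 + s * h) ^ 2) ≤ 2 * (s * h) := by
      rw [hlog]
      linarith [Real.log_le_sub_one_of_pos hy]
    have h2 := mul_le_mul_of_nonneg_left h1 h0
    have h3 := mul_le_mul_of_nonneg_left hyB (by positivity : 0 ≤ s * h ^ 2)
    nlinarith
  · have h1 := mul_le_mul_of_nonneg_left (Real.one_sub_inv_le_log_of_pos hy) hy.le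
    rw [mul_sub, mul_inv_cancel₀ hy.ne'] at h1
    have h2 : s * h ≤ (1 + s * h) * Real.log (1 + s * h) := by linarith
    have h3 := mul_le_mul_of_nonpos_left h2 h0
    rw [hlog]
    nlinarith

lemma pent_one_add_sq_le {p : α → ℝ} (hp : ∀ a, 0 ≤ p a) (hp1 : ∑ a, p a = 1)
    {pm : ℝ} (hpm : 0 < pm) (hpm1 : pm ≤ 1) (hmin : ∀ a, 0 < p a → pm ≤ p a)
    {h : α → ℝ} (hh : ∀ a, 0 ≤ 1 + h a) (hmean : pmean p h = 0) :
    pent p (fun a => (1 + h a) ^ 2) ≤ (2 + Real.log (1 / pm)) * pmean p (fun a => h a ^ 2) := by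
  set L := Real.log (1 / pm) with hL
  set v := pmean p (fun a => h a ^ 2) with hv
  have hL0 : 0 ≤ L := Real.log_nonneg (by rw [le_div_iff₀ hpm]; linarith)
  have hv0 : 0 ≤ v := pmean_sq_nonneg hp h
  have hN : ∀ s : ℝ, pmean p (fun a => (1 + s * h a) ^ 2) = 1 + s ^ 2 * v := by
    intro s
    have h1 : ∀ a, p a * (1 + s * h a) ^ 2 =
        p a + 2 * s * (p a * h a) + s ^ 2 * (p a * h a ^ 2) := fun a => by ring
    simp only [pmean] at hmean
    simp only [hv, pmean, h1, Finset.sum_add_distrib, ← Finset.mul_sum, hp1, hmean]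
    ring
  let D : ℝ → ℝ := fun s => (2 + L) * v * s ^ 2 -
    ((∑ a, p a * ((1 + s * h a) ^ 2 * Real.log ((1 + s * h a) ^ 2))) -
      (1 + s ^ 2 * v) * Real.log (1 + s ^ 2 * v))
  have hcont : Continuous D := by
    have hc : ∀ {u : ℝ → ℝ}, Continuous u → Continuous fun s => u s * Real.log (u s) :=
      fun hu => Real.continuous_mul_log.comp hu
    refine Continuous.sub (by fun_prop) (Continuous.sub ?_ (hc (by fun_prop)))
    exact continuous_finsetSum _ fun a _ => continuous_const.mul (hc (by fun_prop))
  have hderiv : ∀ s ∈ Set.Ioo (0 : ℝ) 1, ∃ d, HasDerivAt D d s ∧ 0 ≤ d := by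
    rintro s ⟨hs0, hs1⟩
    have hy : ∀ a, 0 < 1 + s * h a := fun a => by nlinarith [hh a]
    have hNpos : 0 < 1 + s ^ 2 * v := by positivity
    have hlogN : 0 ≤ Real.log (1 + s ^ 2 * v) :=
      Real.log_nonneg (by nlinarith [mul_nonneg (sq_nonneg s) hv0])
    have hd1 : ∀ a, HasDerivAt (fun s : ℝ => (1 + s * h a) ^ 2) (2 * (1 + s * h a) * h a) s := by
      intro a
      exact ((((hasDerivAt_id' s).mul_const (h a)).const_add 1).fun_pow 2).congr_deriv (by norm_num)
    have hd2 : HasDerivAt (fun s : ℝ => 1 + s ^ 2 * v) (2 * s * v) s := by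
      exact ((((hasDerivAt_id' s).fun_pow 2).mul_const v).const_add 1).congr_deriv (by norm_num)
    have hd3 := (HasDerivAt.fun_sum (u := Finset.univ) fun a _ =>
      ((Real.hasDerivAt_mul_log (pow_pos (hy a) 2).ne').comp s (hd1 a)).const_mul (p a)).sub
      ((Real.hasDerivAt_mul_log hNpos.ne').comp s hd2)
    have hd4 := (((hasDerivAt_id s).pow 2).const_mul ((2 + L) * v)).sub hd3
    refine ⟨_, hd4, ?_⟩
    have hterm : ∀ a, p a * ((Real.log ((1 + s * h a) ^ 2) + 1) * (2 * (1 + s * h a) * h a)) ≤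
        (4 + 2 * (L + Real.log (1 + s ^ 2 * v))) * s * (p a * h a ^ 2) +
          (2 * (p a * h a) + 2 * s * (p a * h a ^ 2)) := by
      intro a
      rcases (hp a).eq_or_lt with h0 | h0
      · simp [← h0]
      · have hle : (1 + s * h a) ^ 2 ≤ 1 / pm * (1 + s ^ 2 * v) := by
          rw [← hN s, div_mul_eq_mul_div, one_mul, le_div_iff₀ hpm]
          have h1 : p a * (1 + s * h a) ^ 2 ≤ pmean p (fun a => (1 + s * h a) ^ 2) :=
            Finset.single_le_sum (f := fun a => p a * (1 + s * h a) ^ 2)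
              (fun b _ => mul_nonneg (hp b) (sq_nonneg _)) (Finset.mem_univ a)
          nlinarith [mul_le_mul_of_nonneg_right (hmin a h0) (sq_nonneg (1 + s * h a))]
        have hlog := Real.log_le_log (pow_pos (hy a) 2) hle
        rw [Real.log_mul (by positivity) hNpos.ne'] at hlog
        have := mul_le_mul_of_nonneg_left
          (log_sq_mul_le hs0.le (hy a) (add_nonneg hL0 hlogN) hlog) (hp a)
        nlinarith
    have hsum := Finset.sum_le_sum fun a (_ : a ∈ Finset.univ) => hterm a
    simp only [Finset.sum_add_distrib, ← Finset.mul_sum] at hsum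
    change _ ≤ (4 + 2 * (L + Real.log (1 + s ^ 2 * v))) * s * v +
      (2 * pmean p h + 2 * s * v) at hsum
    rw [hmean] at hsum
    simp only [id, Nat.cast_ofNat, mul_one, Nat.add_one_sub_one, pow_one]
    linarith
  have hmono : MonotoneOn D (Set.Icc 0 1) := by
    refine monotoneOn_of_deriv_nonneg (convex_Icc 0 1) hcont.continuousOn ?_ ?_
    · rw [interior_Icc]
      intro s hs
      obtain ⟨d, hd, -⟩ := hderiv s hs
      exact hd.differentiableAt.differentiableWithinAt
    · rw [interior_Icc]
      intro s hs
      obtain ⟨d, hd, hd0⟩ := hderiv s hs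
      rwa [hd.deriv]
  have h01 := hmono (Set.left_mem_Icc.2 zero_le_one) (Set.right_mem_Icc.2 zero_le_one) zero_le_one
  have hN1 := hN 1
  simp only [one_mul, one_pow] at hN1
  simp only [D] at h01
  norm_num at h01
  rw [pent, hN1]
  norm_num [pmean]
  linarith

/-- Logarithmic Sobolev inequality for the complete graph: the entropy of `g ^ 2` is at most
`2 + log (1 / pm)` times the variance of `g`, where `pm` bounds the atoms from below. -/
lemma pent_sq_le_mul_pvar {p : α → ℝ} (hp : ∀ a, 0 ≤ p a) (hp1 : ∑ a, p a = 1)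
    {pm : ℝ} (hpm : 0 < pm) (hpm1 : pm ≤ 1) (hmin : ∀ a, 0 < p a → pm ≤ p a)
    {g : α → ℝ} (hg : ∀ a, 0 ≤ g a) :
    pent p (fun a => g a ^ 2) ≤ (2 + Real.log (1 / pm)) * pvar p g := by
  have hm0 : 0 ≤ pmean p g := Finset.sum_nonneg fun a _ => mul_nonneg (hp a) (hg a)
  set m := pmean p g with hm
  rcases hm0.eq_or_lt with h0 | hmpos
  · have hz : ∀ a, p a * g a = 0 := fun a =>
      (Finset.sum_eq_zero_iff_of_nonneg
        (fun a _ => mul_nonneg (hp a) (hg a))).1 h0.symm a (Finset.mem_univ a)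
    have h1 : ∀ c : α → ℝ, pmean p (fun a => g a ^ 2 * c a) = 0 := fun c =>
      Finset.sum_eq_zero fun a _ => by
        change p a * (g a ^ 2 * c a) = 0
        rw [sq, mul_assoc, ← mul_assoc, hz a, zero_mul]
    have h2 : pmean p (fun a => g a ^ 2) = 0 := by simpa using h1 1
    rw [pvar_eq hp1, pent, h1 fun a => Real.log (g a ^ 2), h2, ← hm, ← h0]
    simp
  · have hmean : pmean p (fun a => m⁻¹ * g a - 1) = 0 := by
      rw [pmean_sub, pmean_const_mul, pmean_const hp1, ← hm, inv_mul_cancel₀ hmpos.ne', sub_self]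
    have key := pent_one_add_sq_le hp hp1 hpm hpm1 hmin
      (h := fun a => m⁻¹ * g a - 1)
      (fun a => by simpa using mul_nonneg (inv_nonneg.2 hm0) (hg a)) hmean
    have hsq : ∀ a, (m⁻¹ * g a - 1) ^ 2 = (m⁻¹) ^ 2 * (g a - m) ^ 2 := fun a => by
      field_simp
    have hsq' : ∀ a, (m⁻¹ * g a) ^ 2 = (m⁻¹) ^ 2 * g a ^ 2 := fun a => mul_pow _ _ _
    have hne : pmean p (fun a => g a ^ 2) ≠ 0 := by
      have h1 : 0 ≤ pvar p g := pmean_sq_nonneg hp _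
      rw [pvar_eq hp1, ← hm] at h1
      have : 0 < m ^ 2 := by positivity
      linarith
    simp only [add_sub_cancel, hsq, hsq', pmean_const_mul] at key
    rw [pent_const_mul p (by positivity) hne, mul_left_comm] at key
    exact le_of_mul_le_mul_left key (by positivity)

end LogSobolev

/-- A nonnegative log-convex sequence of growth rate at most `r` starts with ratio at most `r`. -/
lemma le_mul_of_log_convex {w : ℕ → ℝ} {r C : ℝ} (hr : 0 ≤ r) (hw : ∀ n, 0 ≤ w n)
    (hconv : ∀ n, w (n + 1) ^ 2 ≤ w n * w (n + 2)) (hC : ∀ n, w n ≤ C * r ^ n) :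
    w 1 ≤ r * w 0 := by
  by_contra! hlt
  have hw1 : 0 < w 1 := (mul_nonneg hr (hw 0)).trans_lt hlt
  have hw0 : 0 < w 0 := by
    refine (hw 0).lt_of_ne fun h => ?_
    have := hconv 0
    rw [← h, zero_mul] at this
    exact absurd this (not_le.2 (pow_pos hw1 2))
  set q := w 1 / w 0 with hq
  have hrq : r < q := by rwa [hq, lt_div_iff₀ hw0]
  have hq0 : 0 < q := hr.trans_lt hrq
  have hstep : ∀ n, 0 < w n ∧ q * w n ≤ w (n + 1) := by
    intro n
    induction n with
    | zero => exact ⟨hw0, by rw [hq, div_mul_cancel₀ _ hw0.ne']⟩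
    | succ n ih =>
      obtain ⟨h1, h2⟩ := ih
      have h3 : 0 < w (n + 1) := (mul_pos hq0 h1).trans_le h2
      refine ⟨h3, le_of_mul_le_mul_left ?_ h1⟩
      nlinarith [hconv n, mul_le_mul_of_nonneg_right h2 h3.le]
  have hgrow : ∀ n, w 0 * q ^ n ≤ w n := by
    intro n
    induction n with
    | zero => simp
    | succ n ih =>
      have := mul_le_mul_of_nonneg_left ih hq0.le
      rw [pow_succ]
      linarith [(hstep n).2]
  rcases hr.eq_or_lt with h0 | hrpos
  · have := hC 1
    rw [← h0] at this
    simp only [pow_one, mul_zero] at this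
    linarith
  · obtain ⟨n, hn⟩ := pow_unbounded_of_one_lt (C / w 0) ((one_lt_div hrpos).2 hrq)
    have h1 := (hgrow n).trans (hC n)
    rw [div_pow, div_lt_div_iff₀ hw0 (pow_pos hrpos n)] at hn
    linarith

section TwoVariables

variable {X Y : Type*} [Fintype X] [Fintype Y] {π : X × Y → ℝ}

lemma margY_mul_condX {y : Y} (hY : margY π y ≠ 0) (x : X) :
    margY π y * condX π y x = π (x, y) := mul_div_cancel₀ _ hY

lemma margX_mul_condY {x : X} (hX : margX π x ≠ 0) (y : Y) :
    margX π x * condY π x y = π (x, y) := mul_div_cancel₀ _ hX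

lemma sum_condX {y : Y} (hY : margY π y ≠ 0) : ∑ x, condX π y x = 1 := by
  simp only [condX, ← Finset.sum_div]
  exact div_self hY

lemma sum_condY {x : X} (hX : margX π x ≠ 0) : ∑ y, condY π x y = 1 := by
  simp only [condY, ← Finset.sum_div]
  exact div_self hX

lemma sum_margX : ∑ x, margX π x = ∑ z, π z := (Fintype.sum_prod_type _).symm

lemma margY_mul_pmean_condX {y : Y} (hY : margY π y ≠ 0) (g : X → ℝ) :
    margY π y * pmean (condX π y) g = ∑ x, π (x, y) * g x := by
  simp only [pmean, Finset.mul_sum, ← mul_assoc, margY_mul_condX hY]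

lemma margX_mul_pmean_condY {x : X} (hX : margX π x ≠ 0) (g : Y → ℝ) :
    margX π x * pmean (condY π x) g = ∑ y, π (x, y) * g y := by
  simp only [pmean, Finset.mul_sum, ← mul_assoc, margX_mul_condY hX]

lemma pmean_margY_pmean_condX_mul (hY : ∀ y, margY π y ≠ 0) (f : X × Y → ℝ) (b : Y → ℝ) :
    pmean (margY π) (fun y => pmean (condX π y) (fun x => f (x, y)) * b y) =
      pmean π (fun z => f z * b z.2) := by
  simp only [pmean, Fintype.sum_prod_type_right]
  refine Finset.sum_congr rfl fun y _ => ?_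
  have := margY_mul_pmean_condX (hY y) (fun x => f (x, y))
  rw [pmean] at this
  rw [← mul_assoc, this, Finset.sum_mul]
  exact Finset.sum_congr rfl fun x _ => by ring

lemma pmean_margX_pmean_condY_mul (hX : ∀ x, margX π x ≠ 0) (f : X × Y → ℝ) (a : X → ℝ) :
    pmean (margX π) (fun x => pmean (condY π x) (fun y => f (x, y)) * a x) =
      pmean π (fun z => f z * a z.1) := by
  simp only [pmean, Fintype.sum_prod_type]
  refine Finset.sum_congr rfl fun x _ => ?_
  have := margX_mul_pmean_condY (hX x) (fun y => f (x, y))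
  rw [pmean] at this
  rw [← mul_assoc, this, Finset.sum_mul]
  exact Finset.sum_congr rfl fun y _ => by ring

/-- The two conditional expectation operators are adjoint to each other. -/
lemma pmean_condX_adjoint (hX : ∀ x, margX π x ≠ 0) (hY : ∀ y, margY π y ≠ 0)
    (a : X → ℝ) (b : Y → ℝ) :
    pmean (margY π) (fun y => pmean (condX π y) a * b y) =
      pmean (margX π) (fun x => a x * pmean (condY π x) b) := by
  have h1 := pmean_margY_pmean_condX_mul hY (fun z => a z.1) b
  have h2 := pmean_margX_pmean_condY_mul hX (fun z => b z.2) a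
  simp only [mul_comm (b _), mul_comm (pmean (condY π _) b)] at h2
  exact h1.trans (by simpa only [mul_comm (a _)] using h2.symm)

/-- Conditional expectation contracts the `L²` norm of centered functions by the geometric mean
of the Dobrushin coefficients of the two conditional distributions. -/
lemma pmean_sq_pmean_condX_le [Nonempty X] [Nonempty Y] (hsum : ∑ z, π z = 1)
    (hX : ∀ x, 0 < margX π x) (hY : ∀ y, 0 < margY π y) {δX δY : ℝ} (hδX : 0 ≤ δX) (hδY : 0 ≤ δY)
    (htvX : ∀ y y', ptv (condX π y) (condX π y') ≤ δX)
    (htvY : ∀ x x', ptv (condY π x) (condY π x') ≤ δY)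
    {a : X → ℝ} (ha : pmean (margX π) a = 0) :
    pmean (margY π) (fun y => pmean (condX π y) a ^ 2) ≤
      δX * δY * pmean (margX π) (fun x => a x ^ 2) := by
  have hX' : ∀ x, margX π x ≠ 0 := fun x => (hX x).ne'
  have hY' : ∀ y, margY π y ≠ 0 := fun y => (hY y).ne'
  have hX0 : ∀ x, 0 ≤ margX π x := fun x => (hX x).le
  have hmarg : ∑ x, margX π x = 1 := sum_margX.trans hsum
  set δ := δX * δY with hδ
  have hδ0 : 0 ≤ δ := mul_nonneg hδX hδY
  let K : (X → ℝ) → Y → ℝ := fun a y => pmean (condX π y) a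
  let T : (X → ℝ) → X → ℝ := fun a x => pmean (condY π x) (K a)
  have hadj : ∀ a a', pmean (margX π) (fun x => a x * T a' x) =
      pmean (margY π) (fun y => K a y * K a' y) :=
    fun a a' => (pmean_condX_adjoint hX' hY' a (K a')).symm
  have hsymm : ∀ a a', pmean (margX π) (fun x => a x * T a' x) =
      pmean (margX π) (fun x => T a x * a' x) := by
    intro a a'
    rw [hadj, show (fun x => T a x * a' x) = fun x => a' x * T a x from
      funext fun x => mul_comm _ _, hadj]
    simp only [mul_comm]
  have hTmean : ∀ a, pmean (margX π) (T a) = pmean (margX π) a := by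
    intro a
    have h1 : T (fun _ => 1) = fun _ => 1 := by
      funext x
      simp only [T, K, pmean_const (sum_condX (hY' _)), pmean_const (sum_condY (hX' _))]
    have := hsymm a fun _ => 1
    rw [h1] at this
    simpa using this.symm
  have hTosc : ∀ a D, (∀ x x', |a x - a x'| ≤ D) → ∀ x x', |T a x - T a x'| ≤ δ * D := by
    intro a D hD
    have hD0 : 0 ≤ D := (abs_nonneg _).trans (hD (Classical.arbitrary X) (Classical.arbitrary X))
    have hK : ∀ y y', |K a y - K a y'| ≤ δX * D := fun y y' =>
      (abs_pmean_sub_pmean_le (by rw [sum_condX (hY' _), sum_condX (hY' _)]) hD).trans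
        (mul_le_mul_of_nonneg_right (htvX y y') hD0)
    intro x x'
    refine (abs_pmean_sub_pmean_le (by rw [sum_condY (hX' _), sum_condY (hX' _)]) hK).trans ?_
    refine (mul_le_mul_of_nonneg_right (htvY x x') (mul_nonneg hδX hD0)).trans_eq ?_
    rw [hδ]
    ring
  let A : ℕ → X → ℝ := fun n => T^[n] a
  have hA : ∀ n, A (n + 1) = T (A n) := fun n => Function.iterate_succ_apply' T n a
  have hAmean : ∀ n, pmean (margX π) (A n) = 0 := by
    intro n
    induction n with
    | zero => exact ha
    | succ n ih => rw [hA, hTmean, ih]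
  obtain ⟨D, hD⟩ : ∃ D, ∀ x x', |a x - a x'| ≤ D := by
    obtain ⟨u, hu⟩ := Finite.exists_max fun z : X × X => |a z.1 - a z.2|
    exact ⟨_, fun x x' => hu (x, x')⟩
  have hAosc : ∀ n x x', |A n x - A n x'| ≤ δ ^ n * D := by
    intro n
    induction n with
    | zero => simpa [A] using hD
    | succ n ih =>
      rw [hA, pow_succ', mul_assoc]
      exact hTosc _ _ ih
  have hAbd : ∀ n x, A n x ^ 2 ≤ (δ ^ n * D) ^ 2 := by
    intro n x
    have h1 : A n x = pmean (margX π) (fun x' => A n x - A n x') := by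
      rw [pmean_sub, pmean_const hmarg, hAmean, sub_zero]
    have h2 : |A n x| ≤ δ ^ n * D := by
      rw [h1, abs_le]
      constructor
      · rw [← pmean_const hmarg (-(δ ^ n * D))]
        exact pmean_mono hX0 fun x' => (abs_le.1 (hAosc n x x')).1
      · rw [← pmean_const hmarg (δ ^ n * D)]
        exact pmean_mono hX0 fun x' => (abs_le.1 (hAosc n x x')).2
    rw [← sq_abs]
    exact pow_le_pow_left₀ (abs_nonneg _) h2 2
  let w : ℕ → ℝ := fun n => pmean (margX π) (fun x => A n x ^ 2)
  have hw0 : ∀ n, 0 ≤ w n := fun n => pmean_sq_nonneg hX0 _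
  have hw : w 1 ≤ δ ^ 2 * w 0 := by
    refine le_mul_of_log_convex (sq_nonneg δ) hw0 (fun n => ?_) (C := D ^ 2) fun n => ?_
    · have h1 : w (n + 1) = pmean (margX π) (fun x => A n x * A (n + 2) x) := by
        rw [hA (n + 1), hsymm, ← hA]
        simp only [w, sq]
      rw [h1]
      exact sq_pmean_mul_le hX0 _ _
    · refine (pmean_mono hX0 (hAbd n)).trans_eq ?_
      rw [pmean_const hmarg]
      ring
  have hK : pmean (margY π) (fun y => K a y ^ 2) = pmean (margX π) (fun x => A 0 x * A 1 x) := by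
    rw [hA 0, hadj]
    simp only [sq]
    rfl
  have hfin : pmean (margY π) (fun y => K a y ^ 2) ^ 2 ≤ (δ * w 0) ^ 2 := by
    rw [hK]
    refine (sq_pmean_mul_le hX0 _ _).trans ?_
    have := mul_le_mul_of_nonneg_left hw (hw0 0)
    change w 0 * w 1 ≤ _
    linarith
  exact le_of_sq_le_sq hfin (mul_nonneg hδ0 (hw0 0))

lemma pmean_margY_pvar_condX (hY : ∀ y, margY π y ≠ 0) (f : X × Y → ℝ) :
    ∑ y, margY π y * pvar (condX π y) (fun x => f (x, y)) = pmean π (fun z => f z ^ 2) -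
      pmean (margY π) (fun y => pmean (condX π y) (fun x => f (x, y)) ^ 2) := by
  have h := pmean_margY_pmean_condX_mul hY (fun z => f z ^ 2) (fun _ => 1)
  simp only [mul_one] at h
  rw [← h, ← pmean_sub]
  exact Finset.sum_congr rfl fun y _ => by rw [pvar_eq (sum_condX (hY y))]

lemma pmean_margX_pvar_condY (hX : ∀ x, margX π x ≠ 0) (f : X × Y → ℝ) :
    ∑ x, margX π x * pvar (condY π x) (fun y => f (x, y)) = pmean π (fun z => f z ^ 2) -
      pmean (margX π) (fun x => pmean (condY π x) (fun y => f (x, y)) ^ 2) := by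
  have h := pmean_margX_pmean_condY_mul hX (fun z => f z ^ 2) (fun _ => 1)
  simp only [mul_one] at h
  rw [← h, ← pmean_sub]
  exact Finset.sum_congr rfl fun x _ => by rw [pvar_eq (sum_condY (hX x))]

/-- Two-variable factorization of variance under Dobrushin-type conditions. -/
lemma pvar_factorization [Nonempty X] [Nonempty Y] (hnn : ∀ z, 0 ≤ π z) (hsum : ∑ z, π z = 1)
    (hX : ∀ x, 0 < margX π x) (hY : ∀ y, 0 < margY π y) {εX εY : ℝ}
    (hεX : εX ∈ Set.Icc (0 : ℝ) 1) (hεY : εY ∈ Set.Icc (0 : ℝ) 1)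
    (htvX : ∀ y y', ptv (condX π y) (condX π y') ≤ 1 - εX)
    (htvY : ∀ x x', ptv (condY π x) (condY π x') ≤ 1 - εY) (f : X × Y → ℝ) :
    (εX + εY) / 2 * pvar π f ≤ (∑ y, margY π y * pvar (condX π y) (fun x => f (x, y))) +
      ∑ x, margX π x * pvar (condY π x) (fun y => f (x, y)) := by
  have hX' : ∀ x, margX π x ≠ 0 := fun x => (hX x).ne'
  have hY' : ∀ y, margY π y ≠ 0 := fun y => (hY y).ne'
  wlog hf : pmean π f = 0 generalizing f
  · have := this (fun z => f z - pmean π f) (by rw [pmean_sub, pmean_const hsum, sub_self])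
    simpa only [pvar_sub_const hsum, pvar_sub_const (sum_condX (hY' _)),
      pvar_sub_const (sum_condY (hX' _))] using this
  rw [pmean_margY_pvar_condX hY', pmean_margX_pvar_condY hX', pvar_eq hsum, hf]
  set a : X → ℝ := fun x => pmean (condY π x) (fun y => f (x, y)) with ha
  set b : Y → ℝ := fun y => pmean (condX π y) (fun x => f (x, y)) with hb
  have hfa : pmean π (fun z => f z * a z.1) = pmean (margX π) (fun x => a x ^ 2) := by
    rw [← pmean_margX_pmean_condY_mul hX' f a]
    simp only [sq, ha]
  have hfb : pmean π (fun z => f z * b z.2) = pmean (margY π) (fun y => b y ^ 2) := by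
    rw [← pmean_margY_pmean_condX_mul hY' f b]
    simp only [sq, hb]
  have haa : pmean π (fun z => a z.1 ^ 2) = pmean (margX π) (fun x => a x ^ 2) := by
    have := pmean_margX_pmean_condY_mul hX' (fun z => a z.1 ^ 2) (fun _ => 1)
    simpa [pmean_const (sum_condY (hX' _))] using this.symm
  have hbb : pmean π (fun z => b z.2 ^ 2) = pmean (margY π) (fun y => b y ^ 2) := by
    have := pmean_margY_pmean_condX_mul hY' (fun z => b z.2 ^ 2) (fun _ => 1)
    simpa [pmean_const (sum_condX (hY' _))] using this.symm
  have hab : pmean π (fun z => a z.1 * b z.2) =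
      pmean (margY π) (fun y => pmean (condX π y) a * b y) :=
    (pmean_margY_pmean_condX_mul hY' (fun z => a z.1) b).symm
  have hamean : pmean (margX π) a = 0 := by
    have := pmean_margX_pmean_condY_mul hX' f (fun _ => 1)
    simpa [hf] using this
  have hcorr := pmean_sq_pmean_condX_le hsum hX hY (sub_nonneg.2 hεX.2) (sub_nonneg.2 hεY.2)
    htvX htvY hamean
  have hcs := sq_pmean_mul_le (fun y => (hY y).le) (fun y => pmean (condX π y) a) b
  rw [← hab] at hcs
  set F := pmean π (fun z => f z ^ 2)
  set α := pmean (margX π) (fun x => a x ^ 2)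
  set β := pmean (margY π) (fun y => b y ^ 2)
  set c := pmean π (fun z => a z.1 * b z.2)
  have hα : 0 ≤ α := pmean_sq_nonneg (fun x => (hX x).le) a
  have hβ : 0 ≤ β := pmean_sq_nonneg (fun y => (hY y).le) b
  obtain ⟨ρ, hρ⟩ : ∃ ρ, ρ = 1 - (εX + εY) / 2 := ⟨_, rfl⟩
  have hρ0 : 0 ≤ ρ := by linarith [hεX.2, hεY.2]
  have hc : 2 * c ≤ ρ * (α + β) := by
    have h1 : c ^ 2 ≤ ρ ^ 2 * (α * β) := by
      have hδρ : (1 - εX) * (1 - εY) ≤ ρ ^ 2 := by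
        rw [hρ]
        nlinarith [sq_nonneg (εX - εY)]
      have h2 := mul_le_mul_of_nonneg_right hcorr hβ
      have h3 := mul_le_mul_of_nonneg_right hδρ (mul_nonneg hα hβ)
      linarith
    refine le_of_sq_le_sq ?_ (mul_nonneg hρ0 (add_nonneg hα hβ))
    nlinarith [mul_nonneg (sq_nonneg ρ) (sq_nonneg (α - β))]
  have hquad : ∀ t : ℝ, 0 ≤ F - 2 * t * (α + β) + t ^ 2 * (α + β + 2 * c) := by
    intro t
    have h1 := pmean_sq_nonneg hnn fun z => f z - t * (a z.1 + b z.2)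
    have h2 : pmean π (fun z => (f z - t * (a z.1 + b z.2)) ^ 2) =
        F - 2 * t * (pmean π (fun z => f z * a z.1) + pmean π (fun z => f z * b z.2)) +
        t ^ 2 * (pmean π (fun z => a z.1 ^ 2) + pmean π (fun z => b z.2 ^ 2) + 2 * c) := by
      simp only [F, c, pmean, Finset.mul_sum, ← Finset.sum_add_distrib, ← Finset.sum_sub_distrib]
      exact Finset.sum_congr rfl fun z _ => by ring
    rwa [h2, hfa, hfb, haa, hbb] at h1
  have hF : α + β ≤ (1 + ρ) * F := by
    have hρ1 : 0 < 1 + ρ := by linarith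
    have h1 := hquad (1 + ρ)⁻¹
    have h2 := mul_nonneg (sq_nonneg (1 + ρ)) h1
    have h3 : (1 + ρ) ^ 2 * (F - 2 * (1 + ρ)⁻¹ * (α + β) + (1 + ρ)⁻¹ ^ 2 * (α + β + 2 * c)) =
        (1 + ρ) ^ 2 * F - 2 * (1 + ρ) * (α + β) + (α + β + 2 * c) := by
      field_simp
    rw [h3] at h2
    refine le_of_mul_le_mul_left ?_ hρ1
    linarith
  rw [hρ] at hF
  linarith

end TwoVariables

/-- **Two-variable factorization of entropy with strong correlation.**
If `d_TV(π_X^y, π_X^{y'}) ≤ 1 - ε_X` and `d_TV(π_Y^x, π_Y^{x'}) ≤ 1 - ε_Y` with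
`ε_X, ε_Y ∈ [0,1]`, `ε_X ε_Y > 0`, then for every nonnegative `f`,
`Ent f ≤ ((4 + 2 log(1/π_min))/(ε_X + ε_Y)) (E[Ent_X f] + E[Ent_Y f])`,
where `π_min` is the least positive value of `π`. -/
theorem ent_factorization_strong_correlation
    {X Y : Type*} [Fintype X] [Fintype Y] [Nonempty X] [Nonempty Y]
    (π : X × Y → ℝ) (hnn : ∀ z, 0 ≤ π z) (hsum : ∑ z, π z = 1)
    (hX : ∀ x, 0 < margX π x) (hY : ∀ y, 0 < margY π y)
    (εX εY : ℝ) (hεX : εX ∈ Set.Icc (0 : ℝ) 1) (hεY : εY ∈ Set.Icc (0 : ℝ) 1)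
    (hpos : 0 < εX * εY)
    (htvX : ∀ y y', ptv (condX π y) (condX π y') ≤ 1 - εX)
    (htvY : ∀ x x', ptv (condY π x) (condY π x') ≤ 1 - εY)
    (πmin : ℝ) (hπmin : IsLeast {p : ℝ | (∃ z, π z = p) ∧ 0 < p} πmin)
    (f : X × Y → ℝ) (hf : ∀ z, 0 ≤ f z) :
    pent π f ≤ ((4 + 2 * Real.log (1 / πmin)) / (εX + εY)) *
      ((∑ y, margY π y * pent (condX π y) (fun x => f (x, y))) +
       (∑ x, margX π x * pent (condY π x) (fun y => f (x, y)))) := by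
  have hX' : ∀ x, margX π x ≠ 0 := fun x => (hX x).ne'
  have hY' : ∀ y, margY π y ≠ 0 := fun y => (hY y).ne'
  have hε : 0 < εX + εY := by
    rcases hεX.1.eq_or_lt with h | h
    · simp [← h] at hpos
    · linarith [hεY.1]
  obtain ⟨⟨z₀, hz₀⟩, hπ0⟩ := hπmin.1
  have hπ1 : πmin ≤ 1 := by
    rw [← hz₀, ← hsum]
    exact Finset.single_le_sum (fun z _ => hnn z) (Finset.mem_univ z₀)
  have hL : 0 ≤ Real.log (1 / πmin) := Real.log_nonneg (by rw [le_div_iff₀ hπ0]; linarith)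
  have hg : ∀ z, 0 ≤ √(f z) := fun z => Real.sqrt_nonneg _
  have hent := pent_sq_le_mul_pvar hnn hsum hπ0 hπ1 (fun z hz => hπmin.2 ⟨⟨z, rfl⟩, hz⟩) hg
  have hvar := pvar_factorization hnn hsum hX hY hεX hεY htvX htvY fun z => √(f z)
  have hcX : ∑ y, margY π y * pvar (condX π y) (fun x => √(f (x, y))) ≤
      ∑ y, margY π y * pent (condX π y) (fun x => √(f (x, y)) ^ 2) :=
    Finset.sum_le_sum fun y _ => mul_le_mul_of_nonneg_left
      (pvar_le_pent_sq (fun x => div_nonneg (hnn _) (hY y).le) (sum_condX (hY' y))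
        fun x => hg (x, y)) (hY y).le
  have hcY : ∑ x, margX π x * pvar (condY π x) (fun y => √(f (x, y))) ≤
      ∑ x, margX π x * pent (condY π x) (fun y => √(f (x, y)) ^ 2) :=
    Finset.sum_le_sum fun x _ => mul_le_mul_of_nonneg_left
      (pvar_le_pent_sq (fun y => div_nonneg (hnn _) (hX x).le) (sum_condY (hX' x))
        fun y => hg (x, y)) (hX x).le
  simp only [Real.sq_sqrt (hf _)] at hent hcX hcY
  rw [div_mul_eq_mul_div, le_div_iff₀ hε]
  have h1 := mul_le_mul_of_nonneg_right hent hε.le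
  have h2 := mul_le_mul_of_nonneg_left (hvar.trans (add_le_add hcX hcY))
    (by linarith : 0 ≤ 4 + 2 * Real.log (1 / πmin))
  linarith
end
end

section
/- Suppose there exists ε ∈ (0,1] such that for every subset Λ ⊆ [n] with |Λ| ≤ n−2, every partial assignment x_Λ with π_Λ(x_Λ) > 0, every pair of distinct indices i, j ∈ [n]∖Λ, and every pair of values x_i, x'_i ∈ 𝒳_i with π_i^{x_Λ}(x_i) > 0 and π_i^{x_Λ}(x'_i) > 0, one has d_TV(π_j^{x_Λ, x_i}, π_j^{x_Λ, x'_i}) ≤ 1 − ε. Then for every function f : 𝒳 → ℝ, Var f ≤ ε^{−(n−1)} · Σ_{i=1}^n E[Var_i f]. -/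
open scoped BigOperators Classical

noncomputable section

variable {n : ℕ} {𝒳 : Fin n → Type*} [∀ i, Fintype (𝒳 i)] [∀ i, Nonempty (𝒳 i)]

/-- Probability of the event `E` under the density `π`. -/
def prEvent (π : (∀ i, 𝒳 i) → ℝ) (E : (∀ i, 𝒳 i) → Prop) : ℝ :=
  ∑ σ ∈ Finset.univ.filter E, π σ

/-- The conditional marginal distribution of coordinate `j` given agreement with `τ`
on the coordinates in `Λ`. -/
def cmarg (π : (∀ i, 𝒳 i) → ℝ) (Λ : Finset (Fin n)) (τ : ∀ i, 𝒳 i) (j : Fin n) :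
    𝒳 j → ℝ :=
  fun c => prEvent π (fun σ => (∀ k ∈ Λ, σ k = τ k) ∧ σ j = c) /
    prEvent π (fun σ => ∀ k ∈ Λ, σ k = τ k)

/-- The conditional density of `π` given that the configuration agrees with `σ`
outside the (free) set `B`. -/
def condD (π : (∀ i, 𝒳 i) → ℝ) (B : Finset (Fin n)) (σ : ∀ i, 𝒳 i) :
    (∀ i, 𝒳 i) → ℝ :=
  fun τ => if ∀ k, k ∉ B → τ k = σ k
    then π τ / prEvent π (fun τ' => ∀ k, k ∉ B → τ' k = σ k)
    else 0

/-- A nonnegative log-convex sequence dominated by `C * r ^ k` has initial ratio at most `r`. -/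
lemma logConvex_one_le_mul_zero {b : ℕ → ℝ} {r C : ℝ} (hr : 0 ≤ r) (hb : ∀ k, 0 ≤ b k)
    (hc : ∀ k, b (k + 1) ^ 2 ≤ b k * b (k + 2)) (hC : ∀ k, b k ≤ C * r ^ k) :
    b 1 ≤ r * b 0 := by
  by_contra! hlt
  have h0 : 0 < b 0 := by
    rcases (hb 0).lt_or_eq with h | h
    · exact h
    · have := hc 0
      simp only [← h, zero_mul, mul_zero, zero_add] at this hlt
      nlinarith
  set s := b 1 / b 0 with hs
  have hrs : r < s := by rwa [hs, lt_div_iff₀ h0]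
  have hs0 : 0 < s := hr.trans_lt hrs
  have step : ∀ k, 0 < b k ∧ s * b k ≤ b (k + 1) := by
    intro k
    induction k with
    | zero => exact ⟨h0, by rw [hs, div_mul_cancel₀ _ h0.ne']⟩
    | succ k ih =>
      obtain ⟨hk, hk'⟩ := ih
      have hk1 : 0 < b (k + 1) := (mul_pos hs0 hk).trans_le hk'
      refine ⟨hk1, ?_⟩
      have h1 := hc k
      have h2 : s * b k * b (k + 1) ≤ b k * b (k + 2) := by nlinarith
      have h3 : b k * (s * b (k + 1)) ≤ b k * b (k + 2) := by linarith
      exact le_of_mul_le_mul_left h3 hk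
  have geo : ∀ k, s ^ k * b 0 ≤ b k := by
    intro k
    induction k with
    | zero => simp
    | succ k ih =>
      calc s ^ (k + 1) * b 0 = s * (s ^ k * b 0) := by ring
        _ ≤ s * b k := by gcongr
        _ ≤ b (k + 1) := (step k).2
  have lim : Filter.Tendsto (fun k : ℕ => C * (r / s) ^ k) Filter.atTop (nhds (C * 0)) :=
    (tendsto_pow_atTop_nhds_zero_of_lt_one (by positivity)
      ((div_lt_one hs0).2 hrs)).const_mul C
  have hle : b 0 ≤ C * 0 := by
    refine ge_of_tendsto' lim fun k => ?_
    rw [div_pow, ← mul_div_assoc, le_div_iff₀ (pow_pos hs0 k), mul_comm]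
    exact (geo k).trans (hC k)
  linarith

/-- A signed weight of total mass zero and total variation at most `2 * δ` integrates a function
of oscillation `c` on its support to at most `δ * c`. -/
lemma abs_sum_mul_le_of_osc {Y : Type*} [Fintype Y] {d h : Y → ℝ} {P : Y → Prop} {δ c : ℝ}
    (hd : ∑ y, d y = 0) (habs : ∑ y, |d y| ≤ 2 * δ) (hsupp : ∀ y, ¬ P y → d y = 0)
    (hc : 0 ≤ c) (hosc : ∀ y y', P y → P y' → |h y - h y'| ≤ c) :
    |∑ y, d y * h y| ≤ δ * c := by
  have hδ : 0 ≤ δ := by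
    have : 0 ≤ ∑ y, |d y| := Finset.sum_nonneg fun _ _ => abs_nonneg _
    linarith
  by_cases hP : ∃ y, P y
  · obtain ⟨y₀, hy₀⟩ := hP
    have hne : (Finset.univ.filter P).Nonempty := ⟨y₀, by simpa using hy₀⟩
    obtain ⟨a, ha, hmax⟩ := Finset.exists_max_image _ h hne
    obtain ⟨b, hb, hmin⟩ := Finset.exists_min_image _ h hne
    simp only [Finset.mem_filter, Finset.mem_univ, true_and] at ha hb hmax hmin
    have hab := (abs_le.1 (hosc a b ha hb)).2
    set m := (h a + h b) / 2 with hm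
    have hsum : ∑ y, d y * h y = ∑ y, d y * (h y - m) := by
      simp only [mul_sub, Finset.sum_sub_distrib, ← Finset.sum_mul, hd, zero_mul, sub_zero]
    rw [hsum]
    calc |∑ y, d y * (h y - m)| ≤ ∑ y, |d y * (h y - m)| := Finset.abs_sum_le_sum_abs _ _
      _ ≤ ∑ y, |d y| * (c / 2) := by
        refine Finset.sum_le_sum fun y _ => ?_
        by_cases hy : P y
        · rw [abs_mul]
          refine mul_le_mul_of_nonneg_left ?_ (abs_nonneg _)
          have := hmax y hy
          have := hmin y hy
          rw [abs_le]
          constructor <;> linarith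
        · simp [hsupp y hy]
      _ = (∑ y, |d y|) * (c / 2) := by rw [Finset.sum_mul]
      _ ≤ 2 * δ * (c / 2) := by gcongr
      _ = δ * c := by ring
  · push Not at hP
    have : ∑ y, d y * h y = 0 := Finset.sum_eq_zero fun y _ => by simp [hsupp y (hP y)]
    rw [this, abs_zero]
    positivity

/-- The averaging operator of the Markov kernel obtained by normalizing the rows of `J`. -/
def rowAvg {X Y : Type*} [Fintype Y] (J : X → Y → ℝ) (h : Y → ℝ) (x : X) : ℝ :=
  (∑ y, J x y * h y) / ∑ y, J x y

lemma sum_mul_rowAvg {X Y : Type*} [Fintype X] [Fintype Y] {J : X → Y → ℝ}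
    (hJ : ∀ x y, 0 ≤ J x y) (g : X → ℝ) (h : Y → ℝ) :
    ∑ x, (∑ y, J x y) * (g x * rowAvg J h x) = ∑ x, ∑ y, J x y * (g x * h y) := by
  refine Finset.sum_congr rfl fun x _ => ?_
  have hg : ∑ y, J x y * (g x * h y) = g x * ∑ y, J x y * h y := by
    rw [Finset.mul_sum]
    exact Finset.sum_congr rfl fun y _ => by ring
  rw [hg, rowAvg]
  by_cases h0 : ∑ y, J x y = 0
  · have hz : ∀ y, J x y = 0 := fun y =>
      (Finset.sum_eq_zero_iff_of_nonneg fun y _ => hJ x y).1 h0 y (Finset.mem_univ y)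
    simp [hz]
  · field_simp

lemma rowAvg_osc_le {X Y : Type*} [Fintype X] [Fintype Y] {J : X → Y → ℝ}
    (hJ : ∀ x y, 0 ≤ J x y) {δ c : ℝ}
    (htv : ∀ x x', 0 < ∑ y, J x y → 0 < ∑ y, J x' y →
      ∑ y, |J x y / (∑ y, J x y) - J x' y / (∑ y, J x' y)| ≤ 2 * δ)
    (hc : 0 ≤ c) {h : Y → ℝ}
    (hosc : ∀ y y', 0 < ∑ x, J x y → 0 < ∑ x, J x y' → |h y - h y'| ≤ c)
    (x x' : X) (hx : 0 < ∑ y, J x y) (hx' : 0 < ∑ y, J x' y) :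
    |rowAvg J h x - rowAvg J h x'| ≤ δ * c := by
  have hrw : rowAvg J h x - rowAvg J h x' =
      ∑ y, (J x y / (∑ y, J x y) - J x' y / (∑ y, J x' y)) * h y := by
    simp only [rowAvg, sub_mul, Finset.sum_sub_distrib, Finset.sum_div]
    congr 1 <;> exact Finset.sum_congr rfl fun y _ => by ring
  rw [hrw]
  refine abs_sum_mul_le_of_osc (P := fun y => 0 < ∑ x, J x y) ?_ (htv x x' hx hx') ?_ hc hosc
  · rw [Finset.sum_sub_distrib, ← Finset.sum_div, ← Finset.sum_div, div_self hx.ne',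
      div_self hx'.ne', sub_self]
  · intro y hy
    have h0 : ∑ x, J x y = 0 := le_antisymm (not_lt.1 hy) (Finset.sum_nonneg fun x _ => hJ x y)
    have hz : ∀ x, J x y = 0 := fun x =>
      (Finset.sum_eq_zero_iff_of_nonneg fun x _ => hJ x y).1 h0 x (Finset.mem_univ x)
    simp [hz]

/-- Cauchy–Schwarz for a nonnegative weight. -/
lemma sq_sum_weight_mul_le {X : Type*} [Fintype X] {p : X → ℝ} (hp : ∀ x, 0 ≤ p x)
    (u v : X → ℝ) :
    (∑ x, p x * (u x * v x)) ^ 2 ≤ (∑ x, p x * u x ^ 2) * ∑ x, p x * v x ^ 2 :=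
  Finset.sum_sq_le_sum_mul_sum_of_sq_le_mul _
    (fun x _ => mul_nonneg (hp x) (sq_nonneg _)) (fun x _ => mul_nonneg (hp x) (sq_nonneg _))
    (fun x _ => le_of_eq (by ring))

lemma sum_weight_sq_le_of_osc {X : Type*} [Fintype X] {p w : X → ℝ} {c : ℝ}
    (hp : ∀ x, 0 ≤ p x) (hw : ∑ x, p x * w x = 0)
    (hosc : ∀ x x', 0 < p x → 0 < p x' → |w x - w x'| ≤ c) :
    ∑ x, p x * w x ^ 2 ≤ (∑ x, p x) * c ^ 2 := by
  rw [Finset.sum_mul]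
  refine Finset.sum_le_sum fun x _ => ?_
  rcases (hp x).lt_or_eq with hx | hx
  · refine mul_le_mul_of_nonneg_left ?_ (hp x)
    have hpos : 0 < ∑ x', p x' :=
      hx.trans_le (Finset.single_le_sum (fun x' _ => hp x') (Finset.mem_univ x))
    have heq : (∑ x', p x') * w x = ∑ x', p x' * (w x - w x') := by
      simp only [mul_sub, Finset.sum_sub_distrib, hw, sub_zero, Finset.sum_mul]
    have hle : (∑ x', p x') * |w x| ≤ (∑ x', p x') * c := by
      calc (∑ x', p x') * |w x| = |∑ x', p x' * (w x - w x')| := by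
            rw [← heq, abs_mul, abs_of_pos hpos]
        _ ≤ ∑ x', |p x' * (w x - w x')| := Finset.abs_sum_le_sum_abs _ _
        _ ≤ ∑ x', p x' * c := by
          refine Finset.sum_le_sum fun x' _ => ?_
          rw [abs_mul, abs_of_nonneg (hp x')]
          rcases (hp x').lt_or_eq with hx' | hx'
          · exact mul_le_mul_of_nonneg_left (hosc x x' hx hx') (hp x')
          · simp [← hx']
        _ = (∑ x', p x') * c := by rw [Finset.sum_mul]
    have := le_of_mul_le_mul_left hle hpos
    rw [← sq_abs (w x)]
    gcongr
  · simp [← hx]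

/-- If both conditional kernels of a joint weight `J` contract total variation by `δ`, then
functions of the two coordinates, one of them centred, have correlation at most `δ`. -/
lemma sum_joint_mul_le_of_tv {X Y : Type*} [Fintype X] [Fintype Y] {J : X → Y → ℝ}
    (hJ : ∀ x y, 0 ≤ J x y) {δ : ℝ} (hδ : 0 ≤ δ)
    (hrow : ∀ x x', 0 < ∑ y, J x y → 0 < ∑ y, J x' y →
      ∑ y, |J x y / (∑ y, J x y) - J x' y / (∑ y, J x' y)| ≤ 2 * δ)
    (hcol : ∀ y y', 0 < ∑ x, J x y → 0 < ∑ x, J x y' →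
      ∑ x, |J x y / (∑ x, J x y) - J x y' / (∑ x, J x y')| ≤ 2 * δ)
    {g : X → ℝ} (hg : ∑ x, (∑ y, J x y) * g x = 0) (h : Y → ℝ) :
    ∑ x, ∑ y, J x y * (g x * h y) ≤
      δ / 2 * (∑ x, (∑ y, J x y) * g x ^ 2 + ∑ y, (∑ x, J x y) * h y ^ 2) := by
  set p : X → ℝ := fun x => ∑ y, J x y with hp
  set q : Y → ℝ := fun y => ∑ x, J x y with hq
  have hp0 : ∀ x, 0 ≤ p x := fun x => Finset.sum_nonneg fun y _ => hJ x y
  have hq0 : ∀ y, 0 ≤ q y := fun y => Finset.sum_nonneg fun x _ => hJ x y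
  let U : (X → ℝ) → Y → ℝ := rowAvg fun y x => J x y
  let A : (X → ℝ) → X → ℝ := fun w => rowAvg J (U w)
  have hU : ∀ (u : X → ℝ) (v : Y → ℝ),
      ∑ y, q y * (v y * U u y) = ∑ x, ∑ y, J x y * (u x * v y) := by
    intro u v
    rw [sum_mul_rowAvg (fun y x => hJ x y), Finset.sum_comm]
    exact Finset.sum_congr rfl fun x _ => Finset.sum_congr rfl fun y _ => by ring
  have hA : ∀ u w : X → ℝ, ∑ x, p x * (u x * A w x) = ∑ y, q y * (U w y * U u y) := by
    intro u w
    rw [sum_mul_rowAvg hJ, hU]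
  have hAsymm : ∀ u w : X → ℝ, ∑ x, p x * (u x * A w x) = ∑ x, p x * (A u x * w x) := by
    intro u w
    rw [hA]
    simp only [mul_comm (A u _)]
    rw [hA]
    exact Finset.sum_congr rfl fun y _ => by ring
  have hAmean : ∀ w : X → ℝ, ∑ x, p x * A w x = ∑ x, p x * w x := by
    intro w
    have h1 := sum_mul_rowAvg hJ (fun _ => 1) (U w)
    have h2 := hU w (fun _ => 1)
    simp only [one_mul, mul_one] at h1 h2
    rw [Finset.sum_comm] at h1
    simp only [← Finset.sum_mul] at h1 h2
    exact h1.trans h2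
  let v : ℕ → X → ℝ := fun k => A^[k] g
  have hvs : ∀ k, v (k + 1) = A (v k) := fun k => Function.iterate_succ_apply' A k g
  have hvmean : ∀ k, ∑ x, p x * v k x = 0 := by
    intro k
    induction k with
    | zero => exact hg
    | succ k ih => rw [hvs, hAmean, ih]
  set c := 2 * ∑ x, |g x| with hcdef
  have hc0 : 0 ≤ c := by positivity
  have hvosc : ∀ k x x', 0 < p x → 0 < p x' → |v k x - v k x'| ≤ δ ^ (2 * k) * c := by
    intro k
    induction k with
    | zero =>
      intro x x' _ _
      have hle : ∀ z, |g z| ≤ ∑ x, |g x| := fun z =>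
        Finset.single_le_sum (f := fun x => |g x|) (fun _ _ => abs_nonneg _) (Finset.mem_univ z)
      have h1 := hle x
      have h2 := hle x'
      have h3 := abs_sub (g x) (g x')
      simp only [v, Function.iterate_zero, id, mul_zero, pow_zero, one_mul]
      linarith
    | succ k ih =>
      intro x x' hx hx'
      rw [hvs]
      have hstep := rowAvg_osc_le (fun y x => hJ x y) hcol (by positivity) ih
      have := rowAvg_osc_le hJ hrow (by positivity) hstep x x' hx hx'
      refine this.trans_eq ?_
      ring
  have hb1 := logConvex_one_le_mul_zero (b := fun k => ∑ x, p x * v k x ^ 2)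
    (r := δ ^ 4) (C := (∑ x, p x) * c ^ 2) (by positivity)
    (fun k => Finset.sum_nonneg fun x _ => mul_nonneg (hp0 x) (sq_nonneg _))
    (fun k => by
      have h1 : ∑ x, p x * v (k + 1) x ^ 2 = ∑ x, p x * (v k x * v (k + 2) x) := by
        rw [hvs (k + 1), hAsymm, ← hvs k]
        exact Finset.sum_congr rfl fun x _ => by ring
      simp only [h1]
      exact sq_sum_weight_mul_le hp0 _ _)
    (fun k => by
      refine (sum_weight_sq_le_of_osc hp0 (hvmean k) (hvosc k)).trans_eq ?_
      rw [← pow_mul]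
      ring)
  simp only [hvs 0] at hb1
  simp only [v, Function.iterate_zero, id] at hb1
  set b0 := ∑ x, p x * g x ^ 2 with hb0
  set H := ∑ y, q y * h y ^ 2 with hH
  have hb0n : 0 ≤ b0 := Finset.sum_nonneg fun x _ => mul_nonneg (hp0 x) (sq_nonneg _)
  have hHn : 0 ≤ H := Finset.sum_nonneg fun x _ => mul_nonneg (hq0 x) (sq_nonneg _)
  have hUg : ∑ y, q y * U g y ^ 2 ≤ δ ^ 2 * b0 := by
    have h1 : ∑ y, q y * U g y ^ 2 = ∑ x, p x * (g x * A g x) := by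
      rw [hA]
      exact Finset.sum_congr rfl fun y _ => by ring
    rw [h1]
    refine (abs_le_of_sq_le_sq' ?_ (by positivity)).2
    calc _ ≤ b0 * ∑ x, p x * A g x ^ 2 := sq_sum_weight_mul_le hp0 _ _
      _ ≤ b0 * (δ ^ 4 * b0) := by gcongr
      _ = _ := by ring
  rw [← hU]
  refine (abs_le_of_sq_le_sq' ?_ (by positivity)).2
  calc _ ≤ H * ∑ y, q y * U g y ^ 2 := sq_sum_weight_mul_le hq0 _ _
    _ ≤ H * (δ ^ 2 * b0) := by gcongr
    _ ≤ (δ / 2 * (b0 + H)) ^ 2 := by nlinarith [mul_nonneg (sq_nonneg δ) (sq_nonneg (b0 - H))]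

section Product

variable {n : ℕ} {Ω : Fin n → Type*}

/-- The function `h` depends only on the coordinates in `S`. -/
def DependsOnly (S : Finset (Fin n)) (h : (∀ i, Ω i) → ℝ) : Prop :=
  ∀ σ τ, (∀ k ∈ S, τ k = σ k) → h τ = h σ

lemma agree_congr {S : Finset (Fin n)} {σ τ : ∀ i, Ω i} (h : ∀ k ∈ S, τ k = σ k) :
    (fun ρ : ∀ i, Ω i => ∀ k ∈ S, ρ k = τ k) = fun ρ => ∀ k ∈ S, ρ k = σ k := by
  funext ρ
  exact propext (forall₂_congr fun k hk => by rw [h k hk])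

lemma DependsOnly.mono {S T : Finset (Fin n)} (hST : S ⊆ T) {h : (∀ i, Ω i) → ℝ}
    (hh : DependsOnly S h) : DependsOnly T h :=
  fun σ τ hστ => hh σ τ fun k hk => hστ k (hST hk)

variable [∀ i, Fintype (Ω i)]

lemma prEvent_eq_sum_ite (w : (∀ i, Ω i) → ℝ) (E : (∀ i, Ω i) → Prop) :
    prEvent w E = ∑ σ, if E σ then w σ else 0 := by
  rw [prEvent, Finset.sum_filter]

lemma prEvent_nonneg {w : (∀ i, Ω i) → ℝ} (hw : ∀ σ, 0 ≤ w σ) (E : (∀ i, Ω i) → Prop) :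
    0 ≤ prEvent w E :=
  Finset.sum_nonneg fun σ _ => hw σ

lemma prEvent_mono {w : (∀ i, Ω i) → ℝ} (hw : ∀ σ, 0 ≤ w σ) {E E' : (∀ i, Ω i) → Prop}
    (h : ∀ σ, E σ → E' σ) : prEvent w E ≤ prEvent w E' := by
  refine Finset.sum_le_sum_of_subset_of_nonneg ?_ fun σ _ _ => hw σ
  intro σ
  simpa using h σ

lemma prEvent_congr_weight {w w' : (∀ i, Ω i) → ℝ} {E : (∀ i, Ω i) → Prop}
    (h : ∀ σ, E σ → w σ = w' σ) : prEvent w E = prEvent w' E := by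
  refine Finset.sum_congr rfl fun σ hσ => h σ ?_
  simpa using hσ

/-- Disintegration of a restricted sum along the value of one coordinate. -/
lemma sum_prEvent_and_mul (w : (∀ i, Ω i) → ℝ) (E : (∀ i, Ω i) → Prop) (j : Fin n)
    (φ : Ω j → ℝ) :
    ∑ c, prEvent w (fun τ => E τ ∧ τ j = c) * φ c = prEvent (fun τ => w τ * φ (τ j)) E := by
  simp only [prEvent_eq_sum_ite, Finset.sum_mul]
  rw [Finset.sum_comm]
  refine Finset.sum_congr rfl fun τ _ => ?_
  by_cases h : E τ <;> simp [h, ite_mul]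

lemma sum_prEvent_and (w : (∀ i, Ω i) → ℝ) (E : (∀ i, Ω i) → Prop) (j : Fin n) :
    ∑ c, prEvent w (fun τ => E τ ∧ τ j = c) = prEvent w E := by
  simpa using sum_prEvent_and_mul w E j fun _ => 1

lemma cmarg_insert_update (π : (∀ i, Ω i) → ℝ) {Λ : Finset (Fin n)} (σ : ∀ i, Ω i)
    {i : Fin n} (hi : i ∉ Λ) (x : Ω i) (j : Fin n) (c : Ω j) :
    cmarg π (insert i Λ) (Function.update σ i x) j c =
      prEvent π (fun τ => ((∀ k ∈ Λ, τ k = σ k) ∧ τ i = x) ∧ τ j = c) /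
        prEvent π (fun τ => (∀ k ∈ Λ, τ k = σ k) ∧ τ i = x) := by
  have h : ∀ τ : ∀ i, Ω i, (∀ k ∈ insert i Λ, τ k = Function.update σ i x k) ↔
      ((∀ k ∈ Λ, τ k = σ k) ∧ τ i = x) := by
    intro τ
    rw [Finset.forall_mem_insert, Function.update_self, and_comm]
    refine and_congr_left fun _ => forall₂_congr fun k hk => ?_
    rw [Function.update_of_ne (ne_of_mem_of_not_mem hk hi)]
  simp only [cmarg, h]

/-- Conditional expectation of `f` given the coordinates in `S`. -/
def condMean (π : (∀ i, Ω i) → ℝ) (S : Finset (Fin n)) (f : (∀ i, Ω i) → ℝ)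
    (σ : ∀ i, Ω i) : ℝ :=
  prEvent (fun τ => π τ * f τ) (fun τ => ∀ k ∈ S, τ k = σ k) /
    prEvent π (fun τ => ∀ k ∈ S, τ k = σ k)

lemma dependsOnly_condMean (π : (∀ i, Ω i) → ℝ) (S : Finset (Fin n)) (f : (∀ i, Ω i) → ℝ) :
    DependsOnly S (condMean π S f) := by
  intro σ τ h
  rw [condMean, condMean, agree_congr h]

lemma sum_condMean_mul {π : (∀ i, Ω i) → ℝ} (hnn : ∀ σ, 0 ≤ π σ) {S : Finset (Fin n)}
    (f : (∀ i, Ω i) → ℝ) {h : (∀ i, Ω i) → ℝ} (hh : DependsOnly S h) :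
    ∑ σ, π σ * (condMean π S f σ * h σ) = ∑ σ, π σ * (f σ * h σ) := by
  set Z : (∀ i, Ω i) → ℝ := fun σ => prEvent π (fun τ => ∀ k ∈ S, τ k = σ k) with hZ
  have hexp : ∀ σ, π σ * (condMean π S f σ * h σ) =
      ∑ τ, if ∀ k ∈ S, τ k = σ k then π σ * (π τ * f τ / Z τ * h τ) else 0 := by
    intro σ
    rw [condMean, prEvent_eq_sum_ite, Finset.sum_div, Finset.sum_mul, Finset.mul_sum]
    refine Finset.sum_congr rfl fun τ _ => ?_
    by_cases hτ : ∀ k ∈ S, τ k = σ k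
    · simp only [if_pos hτ, hZ]
      rw [hh σ τ hτ, agree_congr hτ]
    · simp [if_neg hτ]
  simp only [hexp]
  rw [Finset.sum_comm]
  refine Finset.sum_congr rfl fun τ _ => ?_
  have hin : (∑ σ, if ∀ k ∈ S, τ k = σ k then π σ * (π τ * f τ / Z τ * h τ) else 0) =
      Z τ * (π τ * f τ / Z τ * h τ) := by
    simp only [hZ]
    rw [prEvent_eq_sum_ite π, Finset.sum_mul]
    refine Finset.sum_congr rfl fun σ _ => ?_
    simp only [eq_comm (a := τ _), ite_mul, zero_mul]
  rw [hin]
  by_cases h0 : Z τ = 0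
  · have hle : π τ ≤ Z τ :=
      Finset.single_le_sum (fun σ _ => hnn σ) (by simp)
    have : π τ = 0 := le_antisymm (h0 ▸ hle) (hnn τ)
    simp [this]
  · field_simp

lemma sum_condMean {π : (∀ i, Ω i) → ℝ} (hnn : ∀ σ, 0 ≤ π σ) (S : Finset (Fin n))
    (f : (∀ i, Ω i) → ℝ) : ∑ σ, π σ * condMean π S f σ = ∑ σ, π σ * f σ := by
  simpa using sum_condMean_mul hnn (S := S) f (h := fun _ => 1) fun _ _ _ => rfl

/-- Tower property, integrated over a cylinder on fewer coordinates. -/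
lemma prEvent_mul_condMean {π : (∀ i, Ω i) → ℝ} (hnn : ∀ σ, 0 ≤ π σ) {Λ S : Finset (Fin n)}
    (hΛ : Λ ⊆ S) (f : (∀ i, Ω i) → ℝ) (σ : ∀ i, Ω i) :
    prEvent (fun τ => π τ * condMean π S f τ) (fun τ => ∀ k ∈ Λ, τ k = σ k) =
      prEvent (fun τ => π τ * f τ) (fun τ => ∀ k ∈ Λ, τ k = σ k) := by
  have hdep : DependsOnly S fun τ => if ∀ k ∈ Λ, τ k = σ k then (1 : ℝ) else 0 := by
    refine DependsOnly.mono hΛ fun ρ τ h => ?_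
    have : (∀ k ∈ Λ, τ k = σ k) ↔ ∀ k ∈ Λ, ρ k = σ k :=
      forall₂_congr fun k hk => by rw [h k hk]
    simp only [this]
  simp only [prEvent_eq_sum_ite]
  convert sum_condMean_mul hnn f hdep using 2 <;>
    split_ifs <;> simp

lemma sum_weight_nonneg_of_prEvent_nonneg {π : (∀ i, Ω i) → ℝ} (hnn : ∀ σ, 0 ≤ π σ)
    (Λ : Finset (Fin n)) {F : (∀ i, Ω i) → ℝ}
    (hF : ∀ σ : ∀ i, Ω i, 0 ≤ prEvent (fun τ => π τ * F τ) (fun τ => ∀ k ∈ Λ, τ k = σ k)) :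
    0 ≤ ∑ σ, π σ * F σ := by
  rw [← sum_condMean hnn Λ]
  exact Finset.sum_nonneg fun σ _ =>
    mul_nonneg (hnn σ) (div_nonneg (hF σ) (prEvent_nonneg hnn _))

/-- Two functions which, given the coordinates in `Λ`, depend on one further coordinate each are
weakly correlated on every cylinder over `Λ`. -/
lemma prEvent_mul_le_of_tv {π : (∀ i, Ω i) → ℝ} (hnn : ∀ σ, 0 ≤ π σ) {δ : ℝ} (hδ : 0 ≤ δ)
    {Λ : Finset (Fin n)} {i j : Fin n} (hi : i ∉ Λ) (hj : j ∉ Λ) (σ : ∀ i, Ω i)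
    (hij : ∀ x x' : Ω i,
      0 < prEvent π (fun τ => (∀ k ∈ Λ, τ k = σ k) ∧ τ i = x) →
      0 < prEvent π (fun τ => (∀ k ∈ Λ, τ k = σ k) ∧ τ i = x') →
      ptv (cmarg π (insert i Λ) (Function.update σ i x) j)
        (cmarg π (insert i Λ) (Function.update σ i x') j) ≤ δ)
    (hji : ∀ x x' : Ω j,
      0 < prEvent π (fun τ => (∀ k ∈ Λ, τ k = σ k) ∧ τ j = x) →
      0 < prEvent π (fun τ => (∀ k ∈ Λ, τ k = σ k) ∧ τ j = x') →
      ptv (cmarg π (insert j Λ) (Function.update σ j x) i)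
        (cmarg π (insert j Λ) (Function.update σ j x') i) ≤ δ)
    {u v : (∀ i, Ω i) → ℝ} (hu : DependsOnly (insert i Λ) u) (hv : DependsOnly (insert j Λ) v)
    (hu0 : prEvent (fun τ => π τ * u τ) (fun τ => ∀ k ∈ Λ, τ k = σ k) = 0) :
    prEvent (fun τ => π τ * (u τ * v τ)) (fun τ => ∀ k ∈ Λ, τ k = σ k) ≤
      δ / 2 * (prEvent (fun τ => π τ * u τ ^ 2) (fun τ => ∀ k ∈ Λ, τ k = σ k) +
        prEvent (fun τ => π τ * v τ ^ 2) (fun τ => ∀ k ∈ Λ, τ k = σ k)) := by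
  have hdep : ∀ {l : Fin n} {w : (∀ i, Ω i) → ℝ}, DependsOnly (insert l Λ) w →
      ∀ τ : ∀ i, Ω i, (∀ k ∈ Λ, τ k = σ k) → w (Function.update σ l (τ l)) = w τ := by
    intro l w hw τ hτ
    refine hw _ _ fun k hk => ?_
    by_cases hkl : k = l
    · subst hkl
      simp
    · rw [Function.update_of_ne hkl, hτ k ((Finset.mem_insert.1 hk).resolve_left hkl)]
  set E : (∀ i, Ω i) → Prop := fun τ => ∀ k ∈ Λ, τ k = σ k with hE
  set J : Ω i → Ω j → ℝ := fun x y => prEvent π (fun τ => (E τ ∧ τ i = x) ∧ τ j = y) with hJ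
  have hJ' : ∀ x y, J x y = prEvent π (fun τ => (E τ ∧ τ j = y) ∧ τ i = x) := fun x y => by
    simp only [hJ, and_right_comm]
  have hp : ∀ x, ∑ y, J x y = prEvent π (fun τ => E τ ∧ τ i = x) := fun x =>
    sum_prEvent_and π _ j
  have hq : ∀ y, ∑ x, J x y = prEvent π (fun τ => E τ ∧ τ j = y) := fun y => by
    simp only [hJ']
    exact sum_prEvent_and π _ i
  set g : Ω i → ℝ := fun x => u (Function.update σ i x) with hg
  set h : Ω j → ℝ := fun y => v (Function.update σ j y) with hh
  have hgu : ∀ τ, E τ → g (τ i) = u τ := hdep hu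
  have hhv : ∀ τ, E τ → h (τ j) = v τ := hdep hv
  have key := sum_joint_mul_le_of_tv (J := J) (fun x y => prEvent_nonneg hnn _) hδ
    (fun x x' hx hx' => by
      rw [hp] at hx hx'
      have := hij x x' hx hx'
      simp only [ptv, cmarg_insert_update π σ hi] at this
      simp only [hp]
      simp only [hJ]
      linarith)
    (fun y y' hy hy' => by
      rw [hq] at hy hy'
      have := hji y y' hy hy'
      simp only [ptv, cmarg_insert_update π σ hj] at this
      simp only [hq]
      simp only [hJ']
      linarith)
    (g := g)
    (by
      simp only [hp]
      rw [sum_prEvent_and_mul, ← hu0]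
      exact prEvent_congr_weight fun τ hτ => by rw [hgu τ hτ])
    h
  have h1 : ∑ x, ∑ y, J x y * (g x * h y) = prEvent (fun τ => π τ * (u τ * v τ)) E := by
    have : ∀ x, ∑ y, J x y * (g x * h y) =
        prEvent (fun τ => π τ * h (τ j)) (fun τ => E τ ∧ τ i = x) * g x := by
      intro x
      rw [← sum_prEvent_and_mul, Finset.sum_mul]
      exact Finset.sum_congr rfl fun y _ => by ring
    simp only [this]
    rw [sum_prEvent_and_mul]
    exact prEvent_congr_weight fun τ hτ => by rw [hgu τ hτ, hhv τ hτ]; ring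
  have h2 : ∑ x, (∑ y, J x y) * g x ^ 2 = prEvent (fun τ => π τ * u τ ^ 2) E := by
    simp only [hp]
    rw [sum_prEvent_and_mul π E i fun x => g x ^ 2]
    exact prEvent_congr_weight fun τ hτ => by rw [hgu τ hτ]
  have h3 : ∑ y, (∑ x, J x y) * h y ^ 2 = prEvent (fun τ => π τ * v τ ^ 2) E := by
    simp only [hq]
    rw [sum_prEvent_and_mul π E j fun y => h y ^ 2]
    exact prEvent_congr_weight fun τ hτ => by rw [hhv τ hτ]
  rwa [h1, h2, h3] at key

/-- Mean square distance of `f` to its conditional expectation given the coordinates in `S`. -/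
def meanCondVar (π : (∀ i, Ω i) → ℝ) (S : Finset (Fin n)) (f : (∀ i, Ω i) → ℝ) : ℝ :=
  ∑ σ, π σ * (f σ - condMean π S f σ) ^ 2

lemma sum_sub_condMean_mul_sub {π : (∀ i, Ω i) → ℝ} (hnn : ∀ σ, 0 ≤ π σ) {S T : Finset (Fin n)}
    (hST : S ⊆ T) (f : (∀ i, Ω i) → ℝ) :
    ∑ σ, π σ * ((f σ - condMean π S f σ) * (condMean π T f σ - condMean π S f σ)) =
      ∑ σ, π σ * (condMean π T f σ - condMean π S f σ) ^ 2 := by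
  have hdep : DependsOnly T fun σ => condMean π T f σ - condMean π S f σ := by
    intro σ τ h
    simp only [dependsOnly_condMean π T f σ τ h,
      (dependsOnly_condMean π S f).mono hST σ τ h]
  have h := sum_condMean_mul hnn f hdep
  rw [← sub_eq_zero, ← Finset.sum_sub_distrib] at h ⊢
  rw [← neg_eq_zero, ← Finset.sum_neg_distrib, ← h]
  exact Finset.sum_congr rfl fun σ _ => by ring

/-- One step of the local-to-global argument: revealing one more coordinate. -/
lemma meanCondVar_le_sum_insert {π : (∀ i, Ω i) → ℝ} (hnn : ∀ σ, 0 ≤ π σ) {δ : ℝ} (hδ : 0 ≤ δ)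
    {Λ : Finset (Fin n)} {m : ℕ} (hm : Λᶜ.card = m + 1)
    (htv : ∀ σ : ∀ i, Ω i, ∀ i j : Fin n, i ∉ Λ → j ∉ Λ → i ≠ j → ∀ x x' : Ω i,
      0 < prEvent π (fun τ => (∀ k ∈ Λ, τ k = σ k) ∧ τ i = x) →
      0 < prEvent π (fun τ => (∀ k ∈ Λ, τ k = σ k) ∧ τ i = x') →
      ptv (cmarg π (insert i Λ) (Function.update σ i x) j)
        (cmarg π (insert i Λ) (Function.update σ i x') j) ≤ δ)
    (f : (∀ i, Ω i) → ℝ) :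
    m * (1 - δ) * meanCondVar π Λ f ≤ ∑ i ∈ Λᶜ, meanCondVar π (insert i Λ) f := by
  set g : Fin n → (∀ i, Ω i) → ℝ :=
    fun i σ => condMean π (insert i Λ) f σ - condMean π Λ f σ with hg
  set f0 : (∀ i, Ω i) → ℝ := fun σ => f σ - condMean π Λ f σ with hf0
  set V := meanCondVar π Λ f with hV
  have hVf0 : V = ∑ σ, π σ * f0 σ ^ 2 := rfl
  set N : Fin n → ℝ := fun i => ∑ σ, π σ * g i σ ^ 2 with hN
  have hproj : ∀ i, ∑ σ, π σ * (f0 σ * g i σ) = N i := fun i =>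
    sum_sub_condMean_mul_sub hnn (Finset.subset_insert i Λ) f
  have hVins : ∀ i, meanCondVar π (insert i Λ) f = V - N i := by
    intro i
    have : meanCondVar π (insert i Λ) f =
        V - 2 * ∑ σ, π σ * (f0 σ * g i σ) + N i := by
      rw [hVf0, Finset.mul_sum, ← Finset.sum_sub_distrib, ← Finset.sum_add_distrib]
      exact Finset.sum_congr rfl fun σ _ => by simp only [hf0, hg]; ring
    rw [this, hproj]
    ring
  have hdep : ∀ i, DependsOnly (insert i Λ) (g i) := by
    intro i σ τ h
    simp only [hg, dependsOnly_condMean π (insert i Λ) f σ τ h,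
      (dependsOnly_condMean π Λ f).mono (Finset.subset_insert i Λ) σ τ h]
  have hmean : ∀ (i : Fin n) (σ : ∀ i, Ω i),
      prEvent (fun τ => π τ * g i τ) (fun τ => ∀ k ∈ Λ, τ k = σ k) = 0 := by
    intro i σ
    have h1 := prEvent_mul_condMean hnn (Finset.subset_insert i Λ) f σ
    have h2 := prEvent_mul_condMean hnn (Finset.Subset.refl Λ) f σ
    rw [← sub_eq_zero.2 (h1.trans h2.symm)]
    simp only [prEvent, hg, mul_sub, Finset.sum_sub_distrib]
  have hcorr : ∀ i ∈ Λᶜ, ∀ j ∈ Λᶜ, i ≠ j →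
      ∑ σ, π σ * (g i σ * g j σ) ≤ δ / 2 * (N i + N j) := by
    intro i hi j hj hij
    rw [Finset.mem_compl] at hi hj
    have := sum_weight_nonneg_of_prEvent_nonneg hnn Λ
      (F := fun σ => δ / 2 * (g i σ ^ 2 + g j σ ^ 2) - g i σ * g j σ) (fun σ => by
        have h := prEvent_mul_le_of_tv hnn hδ hi hj σ (htv σ i j hi hj hij)
          (htv σ j i hj hi hij.symm) (hdep i) (hdep j) (hmean i σ)
        rw [← sub_nonneg] at h
        refine h.trans_eq ?_
        simp only [prEvent]
        rw [← Finset.sum_add_distrib, Finset.mul_sum, ← Finset.sum_sub_distrib]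
        exact Finset.sum_congr rfl fun τ _ => by ring)
    rw [← sub_nonneg]
    refine this.trans_eq ?_
    simp only [hN]
    rw [← Finset.sum_add_distrib, Finset.mul_sum, ← Finset.sum_sub_distrib]
    exact Finset.sum_congr rfl fun τ _ => by ring
  set S := ∑ i ∈ Λᶜ, N i with hS
  set K : ℝ := 1 + m * δ with hK
  have hK0 : 0 < K := by positivity
  have hG : ∑ σ, π σ * (∑ i ∈ Λᶜ, g i σ) ^ 2 ≤ K * S := by
    have hexp : ∑ σ, π σ * (∑ i ∈ Λᶜ, g i σ) ^ 2 =
        ∑ i ∈ Λᶜ, ∑ j ∈ Λᶜ, ∑ σ, π σ * (g i σ * g j σ) := by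
      simp only [sq, Finset.sum_mul_sum]
      simp only [Finset.mul_sum]
      rw [Finset.sum_comm]
      exact Finset.sum_congr rfl fun i _ => Finset.sum_comm
    have hterm : ∀ i ∈ Λᶜ, ∀ j ∈ Λᶜ, ∑ σ, π σ * (g i σ * g j σ) ≤
        δ / 2 * (N i + N j) + if i = j then (1 - δ) * N i else 0 := by
      intro i hi j hj
      by_cases hij : i = j
      · subst hij
        have : ∑ σ, π σ * (g i σ * g i σ) = N i :=
          Finset.sum_congr rfl fun σ _ => by ring
        rw [this, if_pos rfl]
        linarith
      · simpa [hij] using hcorr i hi j hj hij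
    rw [hexp]
    refine (Finset.sum_le_sum fun i hi => Finset.sum_le_sum fun j hj =>
      hterm i hi j hj).trans_eq ?_
    have hinner : ∀ i ∈ Λᶜ,
        (∑ j ∈ Λᶜ, (δ / 2 * (N i + N j) + if i = j then (1 - δ) * N i else 0)) =
          δ / 2 * ((m + 1) * N i + S) + (1 - δ) * N i := by
      intro i hi
      rw [Finset.sum_add_distrib, ← Finset.mul_sum, Finset.sum_add_distrib, Finset.sum_const,
        Finset.sum_ite_eq, if_pos hi, hm, nsmul_eq_mul]
      push_cast
      rfl
    rw [Finset.sum_congr rfl hinner, Finset.sum_add_distrib, ← Finset.mul_sum, ← Finset.mul_sum,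
      Finset.sum_add_distrib, ← Finset.mul_sum, Finset.sum_const, hm, nsmul_eq_mul]
    push_cast
    rw [hK]
    ring
  have hcross : ∑ σ, π σ * (f0 σ * ∑ i ∈ Λᶜ, g i σ) = S := by
    simp only [Finset.mul_sum]
    rw [Finset.sum_comm]
    exact Finset.sum_congr rfl fun i _ => hproj i
  have hsq : 0 ≤ ∑ σ, π σ * (K * f0 σ - ∑ i ∈ Λᶜ, g i σ) ^ 2 :=
    Finset.sum_nonneg fun σ _ => mul_nonneg (hnn σ) (sq_nonneg _)
  have hsq' : ∑ σ, π σ * (K * f0 σ - ∑ i ∈ Λᶜ, g i σ) ^ 2 =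
      K ^ 2 * V - 2 * K * S + ∑ σ, π σ * (∑ i ∈ Λᶜ, g i σ) ^ 2 := by
    rw [← hcross, hVf0, Finset.mul_sum, Finset.mul_sum, ← Finset.sum_sub_distrib,
      ← Finset.sum_add_distrib]
    exact Finset.sum_congr rfl fun σ _ => by ring
  have hSK : S ≤ K * V := by
    have : 0 ≤ K * (K * V - S) := by nlinarith
    linarith [nonneg_of_mul_nonneg_right this hK0]
  simp only [hVins]
  rw [Finset.sum_sub_distrib, Finset.sum_const, hm, nsmul_eq_mul]
  push_cast
  rw [hK] at hSK
  linarith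

lemma pow_mul_meanCondVar_le {π : (∀ i, Ω i) → ℝ} (hnn : ∀ σ, 0 ≤ π σ) {ε : ℝ} (hε0 : 0 < ε)
    (hε1 : ε ≤ 1)
    (htv : ∀ Λ : Finset (Fin n), 2 ≤ Λᶜ.card →
      ∀ σ : ∀ i, Ω i, ∀ i j : Fin n, i ∉ Λ → j ∉ Λ → i ≠ j → ∀ x x' : Ω i,
      0 < prEvent π (fun τ => (∀ k ∈ Λ, τ k = σ k) ∧ τ i = x) →
      0 < prEvent π (fun τ => (∀ k ∈ Λ, τ k = σ k) ∧ τ i = x') →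
      ptv (cmarg π (insert i Λ) (Function.update σ i x) j)
        (cmarg π (insert i Λ) (Function.update σ i x') j) ≤ 1 - ε)
    (f : (∀ i, Ω i) → ℝ) (m : ℕ) (Λ : Finset (Fin n)) (hm : Λᶜ.card = m + 1) :
    ε ^ m * meanCondVar π Λ f ≤ ∑ i ∈ Λᶜ, meanCondVar π {i}ᶜ f := by
  induction m generalizing Λ with
  | zero =>
    obtain ⟨i, hi⟩ := Finset.card_eq_one.1 hm
    have : Λ = {i}ᶜ := by rw [← hi, compl_compl]
    simp [this]
  | succ m ih =>
    have hstep := meanCondVar_le_sum_insert hnn (sub_nonneg.2 hε1) hm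
      (htv Λ (by omega)) f
    rw [sub_sub_cancel] at hstep
    have hins : ∀ i ∈ Λᶜ, ε ^ m * meanCondVar π (insert i Λ) f ≤
        (∑ j ∈ Λᶜ, meanCondVar π {j}ᶜ f) - meanCondVar π {i}ᶜ f := by
      intro i hi
      have hc : (insert i Λ)ᶜ = Λᶜ.erase i := by rw [Finset.compl_insert]
      have := ih (insert i Λ) (by rw [hc, Finset.card_erase_of_mem hi, hm]; rfl)
      rw [hc] at this
      have hadd := Finset.add_sum_erase Λᶜ (fun j => meanCondVar π {j}ᶜ f) hi
      linarith
    have hpos : (0 : ℝ) < (m + 1 : ℕ) := by positivity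
    refine le_of_mul_le_mul_left ?_ hpos
    calc ((m + 1 : ℕ) : ℝ) * (ε ^ (m + 1) * meanCondVar π Λ f)
        = ε ^ m * (((m + 1 : ℕ) : ℝ) * ε * meanCondVar π Λ f) := by ring
      _ ≤ ε ^ m * ∑ i ∈ Λᶜ, meanCondVar π (insert i Λ) f := by gcongr
      _ = ∑ i ∈ Λᶜ, ε ^ m * meanCondVar π (insert i Λ) f := Finset.mul_sum _ _ _
      _ ≤ ∑ i ∈ Λᶜ, ((∑ j ∈ Λᶜ, meanCondVar π {j}ᶜ f) - meanCondVar π {i}ᶜ f) :=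
        Finset.sum_le_sum hins
      _ = ((m + 1 : ℕ) : ℝ) * ∑ i ∈ Λᶜ, meanCondVar π {i}ᶜ f := by
        rw [Finset.sum_sub_distrib, Finset.sum_const, hm, nsmul_eq_mul]
        push_cast
        ring

lemma pmean_condD (π : (∀ i, Ω i) → ℝ) (B : Finset (Fin n)) (f : (∀ i, Ω i) → ℝ)
    (σ : ∀ i, Ω i) : pmean (condD π B σ) f = condMean π Bᶜ f σ := by
  simp only [pmean, condD, condMean, Finset.mem_compl]
  rw [prEvent_eq_sum_ite (fun τ => π τ * f τ), Finset.sum_div]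
  refine Finset.sum_congr rfl fun τ _ => ?_
  split_ifs <;> ring

lemma pmean_pvar_condD {π : (∀ i, Ω i) → ℝ} (hnn : ∀ σ, 0 ≤ π σ) (B : Finset (Fin n))
    (f : (∀ i, Ω i) → ℝ) :
    pmean π (fun σ => pvar (condD π B σ) f) = meanCondVar π Bᶜ f := by
  have h : ∀ σ, pvar (condD π B σ) f =
      condMean π Bᶜ (fun τ => (f τ - condMean π Bᶜ f τ) ^ 2) σ := by
    intro σ
    rw [pvar, pmean_condD, pmean_condD]
    refine congrArg (· / _) (prEvent_congr_weight fun τ hτ => ?_)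
    simp only [dependsOnly_condMean π Bᶜ f σ τ hτ]
  simp only [pmean, h]
  exact sum_condMean hnn _ _

lemma pvar_eq_meanCondVar_empty {π : (∀ i, Ω i) → ℝ} (hsum : ∑ σ, π σ = 1)
    (f : (∀ i, Ω i) → ℝ) : pvar π f = meanCondVar π ∅ f := by
  simp [pvar, meanCondVar, condMean, prEvent, pmean, hsum]

end Product

/-- **Crude approximate tensorization of variance via pairwise influence bounds.**
If for every partial assignment on at most `n−2` coordinates, conditioning any further
coordinate `i` on two values changes the conditional marginal of any other coordinate
`j` by at most `1−ε` in total variation, then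
`Var f ≤ ε^{−(n−1)} Σ_i E[Var_i f]`. -/
theorem var_tensorization_crude_bound
    {n : ℕ} {𝒳 : Fin n → Type*} [∀ i, Fintype (𝒳 i)] [∀ i, Nonempty (𝒳 i)]
    (π : (∀ i, 𝒳 i) → ℝ) (hnn : ∀ σ, 0 ≤ π σ) (hsum : ∑ σ, π σ = 1)
    (hmarg : ∀ (i : Fin n) (c : 𝒳 i), 0 < prEvent π (fun σ => σ i = c))
    (ε : ℝ) (hε0 : 0 < ε) (hε1 : ε ≤ 1)
    (hinf : ∀ Λ : Finset (Fin n), Λ.card ≤ n - 2 →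
      ∀ τ : ∀ i, 𝒳 i, 0 < prEvent π (fun σ => ∀ k ∈ Λ, σ k = τ k) →
      ∀ i j : Fin n, i ∉ Λ → j ∉ Λ → i ≠ j →
      ∀ xi xi' : 𝒳 i,
        0 < prEvent π (fun σ => (∀ k ∈ Λ, σ k = τ k) ∧ σ i = xi) →
        0 < prEvent π (fun σ => (∀ k ∈ Λ, σ k = τ k) ∧ σ i = xi') →
        ptv (cmarg π (insert i Λ) (Function.update τ i xi) j)
            (cmarg π (insert i Λ) (Function.update τ i xi') j) ≤ 1 - ε)
    (f : (∀ i, 𝒳 i) → ℝ) :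
    pvar π f ≤ (1 / ε ^ (n - 1)) *
      ∑ i : Fin n, pmean π (fun σ => pvar (condD π {i} σ) f) := by
  rw [pvar_eq_meanCondVar_empty hsum]
  simp only [pmean_pvar_condD hnn]
  rcases Nat.eq_zero_or_pos n with hn | hn
  · subst hn
    have hone : ∀ σ, π σ = 1 := fun σ => by rw [← hsum, Fintype.sum_subsingleton _ σ]
    have : ∀ σ, condMean π ∅ f σ = f σ := fun σ => by
      simp only [condMean, prEvent, hone]
      simp [Finset.univ_unique, Subsingleton.elim (default : ∀ i, 𝒳 i) σ]
    simp [meanCondVar, this]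
  · have hmain := pow_mul_meanCondVar_le hnn hε0 hε1 (fun Λ hΛ σ i j hi hj hij x x' hx hx' =>
      hinf Λ (by rw [Finset.card_compl, Fintype.card_fin] at hΛ; omega) σ
        (hx.trans_le (prEvent_mono hnn fun τ h => h.1)) i j hi hj hij x x' hx hx')
      f (n - 1) ∅ (by rw [Finset.compl_empty, Finset.card_univ, Fintype.card_fin]; omega)
    rw [Finset.compl_empty] at hmain
    rw [one_div_mul_eq_div, le_div_iff₀ (pow_pos hε0 _), mul_comm]
    exact hmain

end
end
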